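/- arXiv:2502.05552 — 4 statements merged into one kernel-verified Lean document; each statement's English description precedes it below -/
import Mathlib

section
/- Let τ ∈ [0, 1/2), p := 1/(6(1−2τ)²), q := 1 − 2p, h > 0, and let f : [0,h] → ℝ be four times continuously differentiable. Define K(s;τ) := (h⁵/24)·s⁴ for s ∈ [0,τ]; (h⁵/24)·(s⁴ − 4p(s−τ)³) for s ∈ [τ, 1/2]; (h⁵/24)·((1−s)⁴ + 4p(s−1+τ)³) for s ∈ [1/2, 1−τ]; and (h⁵/24)·(1−s)⁴ for s ∈ [1−τ, 1]. Then ∫₀^h f(x) dx − h·(p·f(τh) + q·f(h/2) + p·f((1−τ)h)) = ∫₀¹ K(s;τ)·f''''(hs) ds. -/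
/-- The Peano kernel `K(s;τ)` of the univariate quadrature (equation (3.7)). -/
noncomputable def peanoK (h τ p s : ℝ) : ℝ :=
  (h^5 / 24) *
    (if s ≤ τ then s^4
     else if s ≤ 1/2 then s^4 - 4*p*(s - τ)^3
     else if s ≤ 1 - τ then (1 - s)^4 + 4*p*(s - 1 + τ)^3
     else (1 - s)^4)

open Set MeasureTheory intervalIntegral

/-- Fourfold integration by parts of `g₄` against the quartic `(s - c)⁴ + m (s - d)³`, where
`gᵢ' = h gᵢ₊₁`. -/
theorem integral_quartic_mul_fourth_deriv {h : ℝ} {g₀ g₁ g₂ g₃ g₄ : ℝ → ℝ} {a b : ℝ}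
    (hab : a ≤ b) (c₀ : ContinuousOn g₀ (Icc a b)) (c₁ : ContinuousOn g₁ (Icc a b))
    (c₂ : ContinuousOn g₂ (Icc a b)) (c₃ : ContinuousOn g₃ (Icc a b))
    (c₄ : ContinuousOn g₄ (Icc a b))
    (d₀ : ∀ s ∈ Ioo a b, HasDerivAt g₀ (h * g₁ s) s)
    (d₁ : ∀ s ∈ Ioo a b, HasDerivAt g₁ (h * g₂ s) s)
    (d₂ : ∀ s ∈ Ioo a b, HasDerivAt g₂ (h * g₃ s) s)
    (d₃ : ∀ s ∈ Ioo a b, HasDerivAt g₃ (h * g₄ s) s)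
    (c m d : ℝ) (F : ℝ → ℝ)
    (hF : ∀ s, F s = h / 24 * (((s - c) ^ 4 + m * (s - d) ^ 3) * (h ^ 3 * g₃ s)
      - (4 * (s - c) ^ 3 + 3 * m * (s - d) ^ 2) * (h ^ 2 * g₂ s)
      + (12 * (s - c) ^ 2 + 6 * m * (s - d)) * (h * g₁ s)
      - (24 * (s - c) + 6 * m) * g₀ s)) :
    ∫ s in a..b, h ^ 5 / 24 * ((s - c) ^ 4 + m * (s - d) ^ 3) * g₄ s =
      h * (∫ s in a..b, g₀ s) + F b - F a := by
  have i₁ : IntervalIntegrable (fun s => h ^ 5 / 24 * ((s - c) ^ 4 + m * (s - d) ^ 3) * g₄ s)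
      volume a b := by
    apply ContinuousOn.intervalIntegrable_of_Icc hab
    fun_prop
  have i₂ : IntervalIntegrable (fun s => h * g₀ s) volume a b := by
    apply ContinuousOn.intervalIntegrable_of_Icc hab
    fun_prop
  have key := integral_eq_sub_of_hasDerivAt_of_le (f := F) hab
    (by rw [funext hF]; fun_prop) (fun s hs => ?_) (i₁.sub i₂)
  · rw [integral_sub i₁ i₂, intervalIntegral.integral_const_mul] at key
    linarith
  · rw [funext hF]
    have e (n : ℕ) (z : ℝ) : HasDerivAt (fun s : ℝ => (s - z) ^ n) (n * (s - z) ^ (n - 1) * 1) s :=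
      ((hasDerivAt_id s).sub_const z).pow n
    have e₁ (z : ℝ) : HasDerivAt (fun s : ℝ => s - z) 1 s := (hasDerivAt_id s).sub_const z
    have t₃ := ((e 4 c).add ((e 3 d).const_mul m)).mul ((d₃ s hs).const_mul (h ^ 3))
    have t₂ := (((e 3 c).const_mul 4).add ((e 2 d).const_mul (3 * m))).mul
      ((d₂ s hs).const_mul (h ^ 2))
    have t₁ := (((e 2 c).const_mul 12).add ((e₁ d).const_mul (6 * m))).mul
      ((d₁ s hs).const_mul h)
    have t₀ := (((e₁ c).const_mul 24).add_const (6 * m)).mul (d₀ s hs)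
    refine ((((t₃.sub t₂).add t₁).sub t₀).const_mul (h / 24)).congr_deriv ?_
    simp only [Pi.add_apply]
    push_cast
    ring

theorem hasDerivAt_iteratedDerivWithin_Icc_comp_mul {h : ℝ} (hh : 0 < h) {f : ℝ → ℝ} {n : ℕ}
    (hf : ContDiffOn ℝ (n + 1 : ℕ) f (Icc 0 h)) {s : ℝ} (hs : s ∈ Ioo (0 : ℝ) 1) :
    HasDerivAt (fun s => iteratedDerivWithin n f (Icc 0 h) (h * s))
      (h * iteratedDerivWithin (n + 1) f (Icc 0 h) (h * s)) s := by
  have hmem : h * s ∈ Ioo 0 h := ⟨mul_pos hh hs.1, by nlinarith [hs.2]⟩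
  have hd := (hf.differentiableOn_iteratedDerivWithin (m := n) (by exact_mod_cast n.lt_succ_self)
    (uniqueDiffOn_Icc hh) _ (Ioo_subset_Icc_self hmem)).hasDerivWithinAt
  rw [← iteratedDerivWithin_succ] at hd
  have hd' := hd.hasDerivAt (Icc_mem_nhds hmem.1 hmem.2)
  have hl : HasDerivAt (fun s : ℝ => h * s) h s := by
    simpa using (hasDerivAt_id s).const_mul h
  exact (hd'.comp s hl).congr_deriv (mul_comm _ _)

theorem continuousOn_iteratedDerivWithin_Icc_comp_mul {h : ℝ} (hh : 0 < h) {f : ℝ → ℝ} {n : ℕ}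
    (hf : ContDiffOn ℝ n f (Icc 0 h)) :
    ContinuousOn (fun s => iteratedDerivWithin n f (Icc 0 h) (h * s)) (Icc 0 1) := by
  refine (hf.continuousOn_iteratedDerivWithin le_rfl (uniqueDiffOn_Icc hh)).comp
    (by fun_prop) fun s hs => ⟨mul_nonneg hh.le hs.1, ?_⟩
  nlinarith [hs.2]

theorem continuous_peanoK (h τ p : ℝ) (hτ : τ ≤ 1 / 2) : Continuous (peanoK h τ p) := by
  unfold peanoK
  refine continuous_const.mul ?_
  refine Continuous.if_le (by fun_prop) (Continuous.if_le (by fun_prop) (Continuous.if_le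
    (by fun_prop) (by fun_prop) continuous_id continuous_const ?_) continuous_id
    continuous_const ?_) continuous_id continuous_const ?_
  · rintro s rfl
    ring
  · rintro s rfl
    rw [if_pos (by linarith)]
    ring
  · rintro s rfl
    rw [if_pos hτ]
    ring

theorem peano_kernel_representation
    (τ : ℝ) (hτ : τ ∈ Set.Ico (0:ℝ) (1/2))
    (p q : ℝ) (hp : p = 1 / (6 * (1 - 2*τ)^2)) (hq : q = 1 - 2*p)
    (h : ℝ) (hh : 0 < h)
    (f : ℝ → ℝ) (hf : ContDiffOn ℝ 4 f (Set.Icc 0 h)) :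
    (∫ x in (0:ℝ)..h, f x) -
        h * (p * f (τ*h) + q * f (h/2) + p * f ((1-τ)*h)) =
      ∫ s in (0:ℝ)..1, peanoK h τ p s *
        iteratedDerivWithin 4 f (Set.Icc 0 h) (h*s) := by
  obtain ⟨hτ0, hτ1⟩ := hτ
  set G : ℕ → ℝ → ℝ := fun n s => iteratedDerivWithin n f (Icc 0 h) (h * s) with hG
  have hfn (n : ℕ) (hn : n ≤ 4) : ContDiffOn ℝ n f (Icc 0 h) :=
    hf.of_le (by exact_mod_cast hn)
  have hc (n : ℕ) (hn : n ≤ 4) : ContinuousOn (G n) (Icc 0 1) :=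
    continuousOn_iteratedDerivWithin_Icc_comp_mul hh (hfn n hn)
  have hd (n : ℕ) (hn : n + 1 ≤ 4) (s : ℝ) (hs : s ∈ Ioo (0 : ℝ) 1) :
      HasDerivAt (G n) (h * G (n + 1) s) s :=
    hasDerivAt_iteratedDerivWithin_Icc_comp_mul hh (hfn (n + 1) hn) hs
  have hG0 (s : ℝ) : G 0 s = f (h * s) := by simp [hG]
  have piece (a b : ℝ) (ha : 0 ≤ a) (hab : a ≤ b) (hb : b ≤ 1) (c m d : ℝ)
      (hK : ∀ s ∈ Ioo a b, peanoK h τ p s = h ^ 5 / 24 * ((s - c) ^ 4 + m * (s - d) ^ 3)) :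
      ∫ s in a..b, peanoK h τ p s * G 4 s = _ :=
    (integral_congr_Ioo_of_le hab fun s hs => by rw [hK s hs]).trans <|
    integral_quartic_mul_fourth_deriv hab
      ((hc 0 (by simp)).mono (Icc_subset_Icc ha hb)) ((hc 1 (by simp)).mono (Icc_subset_Icc ha hb))
      ((hc 2 (by simp)).mono (Icc_subset_Icc ha hb)) ((hc 3 (by simp)).mono (Icc_subset_Icc ha hb))
      ((hc 4 (by simp)).mono (Icc_subset_Icc ha hb))
      (fun s hs => hd 0 (by simp) s (Ioo_subset_Ioo ha hb hs))
      (fun s hs => hd 1 (by simp) s (Ioo_subset_Ioo ha hb hs))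
      (fun s hs => hd 2 (by simp) s (Ioo_subset_Ioo ha hb hs))
      (fun s hs => hd 3 (by simp) s (Ioo_subset_Ioo ha hb hs)) c m d _ (fun _ => rfl)
  have p₁ := piece 0 τ le_rfl hτ0 (by linarith) 0 0 0 fun s hs => by
    rw [peanoK, if_pos hs.2.le]; ring
  have p₂ := piece τ (1 / 2) hτ0 hτ1.le (by linarith) 0 (-4 * p) τ fun s hs => by
    rw [peanoK, if_neg hs.1.not_ge, if_pos hs.2.le]; ring
  have p₃ := piece (1 / 2) (1 - τ) (by norm_num) (by linarith) (by linarith) 1 (4 * p) (1 - τ)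
    fun s hs => by
      rw [peanoK, if_neg (by linarith [hs.1]), if_neg hs.1.not_ge, if_pos hs.2.le]; ring
  have p₄ := piece (1 - τ) 1 (by linarith) (by linarith) le_rfl 1 0 0 fun s hs => by
    rw [peanoK, if_neg (by linarith [hs.1]), if_neg (by linarith [hs.1]), if_neg hs.1.not_ge]; ring
  have hsplit (F : ℝ → ℝ) (hF : ContinuousOn F (Icc 0 1)) :
      ∫ s in (0 : ℝ)..1, F s = (∫ s in (0 : ℝ)..τ, F s) + (∫ s in τ..(1 / 2), F s)
        + (∫ s in (1 / 2)..(1 - τ), F s) + ∫ s in (1 - τ)..1, F s := by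
    have hi (a b : ℝ) (ha : 0 ≤ a) (hab : a ≤ b) (hb : b ≤ 1) : IntervalIntegrable F volume a b :=
      (hF.mono (Icc_subset_Icc ha hb)).intervalIntegrable_of_Icc hab
    rw [integral_add_adjacent_intervals (hi _ _ le_rfl hτ0 (by linarith))
        (hi _ _ hτ0 hτ1.le (by norm_num)),
      integral_add_adjacent_intervals (hi _ _ le_rfl (by norm_num) (by norm_num))
        (hi _ _ (by norm_num) (by linarith) (by linarith)),
      integral_add_adjacent_intervals (hi _ _ le_rfl (by linarith) (by linarith))
        (hi _ _ (by linarith) (by linarith) le_rfl)]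
  have hp' : 6 * p * (1 - 2 * τ) ^ 2 = 1 := by
    have : (1 - 2 * τ) ≠ 0 := by linarith
    rw [hp]
    field_simp
  have hscale : h * (∫ s in (0 : ℝ)..1, G 0 s) = ∫ x in (0 : ℝ)..h, f x := by
    simp only [hG0]
    simp
  have hL := hsplit _ (hc 0 (by simp))
  have hR := hsplit (fun s => peanoK h τ p s * G 4 s)
    ((continuous_peanoK h τ p hτ1.le).continuousOn.mul (hc 4 le_rfl))
  change _ = ∫ s in (0 : ℝ)..1, peanoK h τ p s * G 4 s
  have n₁ : f (τ * h) = G 0 τ := by rw [hG0, mul_comm]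
  have n₂ : f (h / 2) = G 0 (1 / 2) := by rw [hG0]; congr 1; ring
  have n₃ : f ((1 - τ) * h) = G 0 (1 - τ) := by rw [hG0, mul_comm]
  rw [hR, p₁, p₂, p₃, p₄, ← hscale, hL, n₁, n₂, n₃, hq]
  linear_combination (-h ^ 3 / 24 * G 2 (1 / 2)) * hp'
end

section
/- Let τ ∈ [0, 1/2), p := 1/(6(1−2τ)²), q := 1 − 2p, r := (1/12)·(1 − 1/(1−2τ) + 1/(6(1−2τ)³)), and h > 0. Set a := τh, m := h/2, c := (1−τ)h. Then for every real polynomial g(η₁,η₂) of total degree at most 2, ∫₀^h ∫₀^{η₁} g(η₁,η₂) dη₂ dη₁ = h²·[ (p²/2)g(c,c) + pq·g(c,m) + p²·g(c,a) + (q²/2)g(m,m) + pq·g(m,a) + (p²/2)g(a,a) ] + h³·r·( ∂₁g(m,m) − ∂₂g(m,m) ). -/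
open MvPolynomial

theorem MvPolynomial.exists_eq_of_totalDegree_le_two {R : Type*} [CommRing R]
    (g : MvPolynomial (Fin 2) R) (hg : g.totalDegree ≤ 2) :
    ∃ a b c d e f : R, g = C a + C b * X 0 + C c * X 1
      + C d * X 0 ^ 2 + C e * (X 0 * X 1) + C f * X 1 ^ 2 := by
  rw [g.as_sum]
  refine Finset.sum_induction _ (fun g : MvPolynomial (Fin 2) R ↦
    ∃ a b c d e f : R, g = C a + C b * X 0 + C c * X 1
      + C d * X 0 ^ 2 + C e * (X 0 * X 1) + C f * X 1 ^ 2) ?_ ?_ ?_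
  · rintro _ _ ⟨a, b, c, d, e, f, rfl⟩ ⟨a', b', c', d', e', f', rfl⟩
    refine ⟨a + a', b + b', c + c', d + d', e + e', f + f', ?_⟩
    simp only [C_add]
    ring
  · exact ⟨0, 0, 0, 0, 0, 0, by simp⟩
  · intro m hm
    have hdeg : m 0 + m 1 ≤ 2 := by
      have := (le_totalDegree hm).trans hg
      rwa [Finsupp.sum_fintype _ _ (fun _ ↦ rfl), Fin.sum_univ_two] at this
    have hmon : monomial m (coeff m g) = C (coeff m g) * (X 0 ^ m 0 * X 1 ^ m 1) := by
      rw [monomial_eq, Finsupp.prod_fintype _ _ (fun _ ↦ pow_zero _), Fin.prod_univ_two]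
    rw [hmon]
    generalize coeff m g = k
    generalize m 0 = i at *
    generalize m 1 = j at *
    have hij : (i = 0 ∧ j = 0) ∨ (i = 1 ∧ j = 0) ∨ (i = 0 ∧ j = 1) ∨ (i = 2 ∧ j = 0) ∨
        (i = 1 ∧ j = 1) ∨ (i = 0 ∧ j = 2) := by omega
    rcases hij with ⟨rfl, rfl⟩ | ⟨rfl, rfl⟩ | ⟨rfl, rfl⟩ | ⟨rfl, rfl⟩ | ⟨rfl, rfl⟩ | ⟨rfl, rfl⟩
    · exact ⟨k, 0, 0, 0, 0, 0, by simp⟩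
    · exact ⟨0, k, 0, 0, 0, 0, by simp⟩
    · exact ⟨0, 0, k, 0, 0, 0, by simp⟩
    · exact ⟨0, 0, 0, k, 0, 0, by simp⟩
    · exact ⟨0, 0, 0, 0, k, 0, by simp⟩
    · exact ⟨0, 0, 0, 0, 0, k, by simp⟩

theorem integral_triangle_quadratic (a b c d e f h : ℝ) :
    (∫ x in (0:ℝ)..h, ∫ y in (0:ℝ)..x,
      (a + b * x + c * y + d * x ^ 2 + e * (x * y) + f * y ^ 2)) =
      a * h ^ 2 / 2 + b * h ^ 3 / 3 + c * h ^ 3 / 6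
        + d * h ^ 4 / 4 + e * h ^ 4 / 8 + f * h ^ 4 / 12 := by
  have inner (x : ℝ) : (∫ y in (0:ℝ)..x,
      (a + b * x + c * y + d * x ^ 2 + e * (x * y) + f * y ^ 2)) =
      a * x + (b + c / 2) * x ^ 2 + (d + e / 2 + f / 3) * x ^ 3 := by
    rw [intervalIntegral.integral_eq_sub_of_hasDerivAt
      (f := fun y ↦ (a + b * x + d * x ^ 2) * y + (c + e * x) / 2 * y ^ 2 + f / 3 * y ^ 3)]
    · ring
    · intro y _
      refine ((((hasDerivAt_id y).const_mul (a + b * x + d * x ^ 2)).add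
        ((hasDerivAt_pow 2 y).const_mul ((c + e * x) / 2))).add
        ((hasDerivAt_pow 3 y).const_mul (f / 3))).congr_deriv ?_
      norm_num
      ring
    · exact Continuous.intervalIntegrable (by fun_prop) _ _
  simp only [inner]
  rw [intervalIntegral.integral_eq_sub_of_hasDerivAt
    (f := fun x ↦ a / 2 * x ^ 2 + (b + c / 2) / 3 * x ^ 3 + (d + e / 2 + f / 3) / 4 * x ^ 4)]
  · ring
  · intro x _
    refine ((((hasDerivAt_pow 2 x).const_mul (a / 2)).add
      ((hasDerivAt_pow 3 x).const_mul ((b + c / 2) / 3))).add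
      ((hasDerivAt_pow 4 x).const_mul ((d + e / 2 + f / 3) / 4))).congr_deriv ?_
    norm_num
    ring
  · exact Continuous.intervalIntegrable (by fun_prop) _ _

theorem quadrature2D_exact_deg2
    (τ : ℝ) (hτ : τ ∈ Set.Ico (0:ℝ) (1/2))
    (p q r : ℝ) (hp : p = 1 / (6 * (1 - 2*τ)^2)) (hq : q = 1 - 2*p)
    (hr : r = (1/12) * (1 - 1/(1 - 2*τ) + 1/(6*(1 - 2*τ)^3)))
    (h : ℝ) (hh : 0 < h)
    (g : MvPolynomial (Fin 2) ℝ) (hg : g.totalDegree ≤ 2) :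
    (∫ η₁ in (0:ℝ)..h, ∫ η₂ in (0:ℝ)..η₁, eval ![η₁, η₂] g) =
      h^2 * (p^2/2 * eval ![(1-τ)*h, (1-τ)*h] g
           + p*q   * eval ![(1-τ)*h, h/2] g
           + p^2   * eval ![(1-τ)*h, τ*h] g
           + q^2/2 * eval ![h/2, h/2] g
           + p*q   * eval ![h/2, τ*h] g
           + p^2/2 * eval ![τ*h, τ*h] g)
      + h^3 * r * (eval ![h/2, h/2] (pderiv 0 g) - eval ![h/2, h/2] (pderiv 1 g)) := by
  obtain ⟨a, b, c, d, e, f, rfl⟩ := g.exists_eq_of_totalDegree_le_two hg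
  have hs : 1 - 2 * τ ≠ 0 := by linarith [hτ.2]
  simp [Derivation.leibniz, Derivation.leibniz_pow, pderiv_X]
  rw [integral_triangle_quadratic]
  obtain ⟨s, rfl⟩ : ∃ s, τ = (1 - s) / 2 := ⟨1 - 2 * τ, by ring⟩
  have hs' : 1 - 2 * ((1 - s) / 2) = s := by ring
  rw [hs'] at hp hr hs
  subst hq hp hr
  field_simp
  ring
end

section
/- Let τ ∈ [0, 1/2), p := 1/(6(1−2τ)²), q := 1 − 2p, r := (1/12)·(1 − 1/(1−2τ) + 1/(6(1−2τ)³)), and h > 0. Set a := τh, m := h/2, c := (1−τ)h, and v₁ = v₃ := p, v₂ := q. Then for every real polynomial g(η₁,η₂,η₃) of total degree at most 1, ∫₀^h ∫₀^{η₁} ∫₀^{η₂} g dη₃ dη₂ dη₁ equals h³ times the sum over all weakly decreasing triples (x₁,x₂,x₃) with entries from {c,m,a} of b·g(x₁,x₂,x₃), where b = v₁^{j₁}v₂^{j₂}v₃^{j₃}/(j₁!j₂!j₃!) and j₁, j₂, j₃ count the occurrences of a, m, c respectively, plus the derivative terms h⁴·p·r·( ∂₂g(c,m,m) − ∂₃g(c,m,m)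 ) + h⁴·(q·r/2)·( ∂₁g(m,m,m) − ∂₃g(m,m,m) ) + h⁴·p·r·( ∂₁g(m,m,a) − ∂₂g(m,m,a) ). -/
open MvPolynomial

/-- A polynomial of total degree at most one is affine. -/
theorem MvPolynomial.eq_C_add_sum_C_mul_X_of_totalDegree_le_one {σ R : Type*} [Fintype σ]
    [CommSemiring R] {f : MvPolynomial σ R} (hf : f.totalDegree ≤ 1) :
    f = C (f.coeff 0) + ∑ i, C (f.coeff (Finsupp.single i 1)) * X i := by
  classical
  ext d
  simp only [coeff_add, coeff_sum, coeff_C, coeff_C_mul, coeff_X, mul_ite, mul_one, mul_zero]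
  rcases Nat.lt_trichotomy d.degree 1 with hd | hd | hd
  · obtain rfl : d = 0 := (Finsupp.degree_eq_zero_iff d).1 (by omega)
    simp
  · obtain ⟨i, rfl⟩ := (Finsupp.sum_eq_one_iff d).1 hd
    simp [Finsupp.single_left_inj, eq_comm (a := (0 : σ →₀ ℕ))]
  · have h0 : d ≠ 0 := by rintro rfl; simp at hd
    have h1 : ∀ i, Finsupp.single i 1 ≠ d := by rintro i rfl; simp at hd
    simpa [h0.symm, h1] using coeff_eq_zero_of_totalDegree_lt (hf.trans_lt hd)

/-- The integral of an affine function over the ordered simplex `h ≥ x ≥ y ≥ z ≥ 0`. -/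
theorem integral_affine_ordered_simplex (h k a b c : ℝ) :
    (∫ x in (0:ℝ)..h, ∫ y in (0:ℝ)..x, ∫ z in (0:ℝ)..y, (k + (a * x + b * y + c * z))) =
      h ^ 3 * (k / 6) + h ^ 4 * (a / 8 + b / 12 + c / 24) := by
  have hz (x y : ℝ) : ∫ z in (0:ℝ)..y, (k + (a * x + b * y + c * z)) =
      (k + a * x) * y + (b + c / 2) * y ^ 2 := by
    have (z : ℝ) : k + (a * x + b * y + c * z) = (k + a * x + b * y) + c * z := by ring
    simp_rw [this]
    rw [intervalIntegral.integral_add (Continuous.intervalIntegrable (by fun_prop) _ _)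
      (Continuous.intervalIntegrable (by fun_prop) _ _), intervalIntegral.integral_const_mul]
    simp
    ring
  have hy (x : ℝ) : ∫ y in (0:ℝ)..x, ((k + a * x) * y + (b + c / 2) * y ^ 2) =
      k / 2 * x ^ 2 + (a / 2 + b / 3 + c / 6) * x ^ 3 := by
    rw [intervalIntegral.integral_add (Continuous.intervalIntegrable (by fun_prop) _ _)
      (Continuous.intervalIntegrable (by fun_prop) _ _), intervalIntegral.integral_const_mul,
      intervalIntegral.integral_const_mul]
    simp
    ring
  simp_rw [hz, hy]
  rw [intervalIntegral.integral_add (Continuous.intervalIntegrable (by fun_prop) _ _)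
      (Continuous.intervalIntegrable (by fun_prop) _ _)]
  simp
  ring

theorem quadrature3D_exact_deg1
    (τ : ℝ) (hτ : τ ∈ Set.Ico (0:ℝ) (1/2))
    (p q r : ℝ) (hp : p = 1 / (6 * (1 - 2*τ)^2)) (hq : q = 1 - 2*p)
    (hr : r = (1/12) * (1 - 1/(1 - 2*τ) + 1/(6*(1 - 2*τ)^3)))
    (h : ℝ) (hh : 0 < h)
    (a m c : ℝ) (ha : a = τ*h) (hm : m = h/2) (hc : c = (1-τ)*h)
    (g : MvPolynomial (Fin 3) ℝ) (hg : g.totalDegree ≤ 1) :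
    (∫ η₁ in (0:ℝ)..h, ∫ η₂ in (0:ℝ)..η₁, ∫ η₃ in (0:ℝ)..η₂, eval ![η₁, η₂, η₃] g) =
      h^3 * (p^3/6   * eval ![c, c, c] g
           + p^2*q/2 * eval ![c, c, m] g
           + p^3/2   * eval ![c, c, a] g
           + p*q^2/2 * eval ![c, m, m] g
           + p^2*q   * eval ![c, m, a] g
           + p^3/2   * eval ![c, a, a] g
           + q^3/6   * eval ![m, m, m] g
           + p*q^2/2 * eval ![m, m, a] g
           + p^2*q/2 * eval ![m, a, a] g
           + p^3/6   * eval ![a, a, a] g)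
      + h^4 * p * r *
          (eval ![c, m, m] (pderiv 1 g) - eval ![c, m, m] (pderiv 2 g))
      + h^4 * (q * r / 2) *
          (eval ![m, m, m] (pderiv 0 g) - eval ![m, m, m] (pderiv 2 g))
      + h^4 * p * r *
          (eval ![m, m, a] (pderiv 0 g) - eval ![m, m, a] (pderiv 1 g)) := by
  have hs : 1 - 2 * τ ≠ 0 := by linarith [hτ.2]
  rw [eq_C_add_sum_C_mul_X_of_totalDegree_le_one hg]
  simp [Fin.sum_univ_three, integral_affine_ordered_simplex]
  subst hp hq hr ha hm hc
  field_simp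
  ring
end

section
/- Let τ ∈ [0, 1/2) and let g : ℝ³ → ℝ be three times continuously differentiable. Let R₃(h) denote the error of the three-dimensional Hermite–Birkhoff quadrature of the paper applied to g over the simplex {h ≥ η₁ ≥ η₂ ≥ η₃ ≥ 0} (i.e. the exact triple integral minus the quadrature of equation (A.3)). Then R₃(h) + (h⁵(432τ⁴ − 864τ³ + 558τ² − 126τ + 7)/(12960(1−2τ)⁴))·( ∂₁²g(0,0,0) − 2∂₂²g(0,0,0) + ∂₃²g(0,0,0) ) − (h⁵(216τ⁴ − 252τ³ + 99τ² − 18τ + 1)/(3240(1−2τ)⁴))·( ∂₁∂₂g(0,0,0) − 2∂₁∂₃g(0,0,0) + ∂₂∂₃g(0,0,0) ) = O(h⁶) as h → 0⁺. -/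
open Asymptotics

/-- Partial derivative in the first variable of a function of three real variables. -/
noncomputable def pd1 (g : ℝ → ℝ → ℝ → ℝ) : ℝ → ℝ → ℝ → ℝ :=
  fun x y z => deriv (fun s => g s y z) x

/-- Partial derivative in the second variable of a function of three real variables. -/
noncomputable def pd2 (g : ℝ → ℝ → ℝ → ℝ) : ℝ → ℝ → ℝ → ℝ :=
  fun x y z => deriv (fun s => g x s z) y

/-- Partial derivative in the third variable of a function of three real variables. -/
noncomputable def pd3 (g : ℝ → ℝ → ℝ → ℝ) : ℝ → ℝ → ℝ → ℝ :=
  fun x y z => deriv (fun s => g x y s) z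

/-- The error of the three-dimensional Hermite–Birkhoff quadrature of the paper
(equation (A.3)) over the simplex `{h ≥ η₁ ≥ η₂ ≥ η₃ ≥ 0}`, with nodes built from
`a = τh`, `m = h/2`, `c = (1−τ)h`, weights from `v₁ = v₃ = p`, `v₂ = q` and
directional-derivative weights built from `r`. -/
noncomputable def R₃ (τ : ℝ) (g : ℝ → ℝ → ℝ → ℝ) (h : ℝ) : ℝ :=
  let p := 1 / (6 * (1 - 2*τ)^2)
  let q := 1 - 2*p
  let r := (1/12) * (1 - 1/(1 - 2*τ) + 1/(6*(1 - 2*τ)^3))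
  let a := τ*h
  let m := h/2
  let c := (1-τ)*h
  (∫ η₁ in (0:ℝ)..h, ∫ η₂ in (0:ℝ)..η₁, ∫ η₃ in (0:ℝ)..η₂, g η₁ η₂ η₃) -
    (h^3 * (p^3/6   * g c c c
          + p^2*q/2 * g c c m
          + p^3/2   * g c c a
          + p*q^2/2 * g c m m
          + p^2*q   * g c m a
          + p^3/2   * g c a a
          + q^3/6   * g m m m
          + p*q^2/2 * g m m a
          + p^2*q/2 * g m a a
          + p^3/6   * g a a a)
     + h^4 * p * r * (pd2 g c m m - pd3 g c m m)
     + h^4 * (q * r / 2) * (pd1 g m m m - pd3 g m m m)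
     + h^4 * p * r * (pd1 g m m a - pd2 g m m a))

theorem isBigO_norm_pow_succ_of_hasFDerivAt {E F : Type*} [NormedAddCommGroup E]
    [NormedSpace ℝ E] [NormedAddCommGroup F] [NormedSpace ℝ F] {f : E → F} {f' : E → E →L[ℝ] F}
    {n : ℕ} (hf : ∀ v, HasFDerivAt f (f' v) v) (h0 : f 0 = 0)
    (hO : f' =O[nhds 0] fun v => ‖v‖ ^ n) : f =O[nhds 0] fun v => ‖v‖ ^ (n + 1) := by
  obtain ⟨c, hc, hb⟩ := hO.exists_nonneg
  obtain ⟨δ, hδ, hball⟩ := Metric.eventually_nhds_iff_ball.1 hb.bound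
  refine IsBigO.of_bound c (Metric.eventually_nhds_iff_ball.2 ⟨δ, hδ, fun v hv => ?_⟩)
  have hbound : ∀ w ∈ Metric.closedBall (0 : E) ‖v‖, ‖f' w‖ ≤ c * ‖v‖ ^ n := by
    intro w hw
    rw [mem_closedBall_zero_iff] at hw
    rw [mem_ball_zero_iff] at hv
    have hw' := hball w (mem_ball_zero_iff.2 (hw.trans_lt hv))
    rw [norm_pow, norm_norm] at hw'
    exact hw'.trans (by gcongr)
  have hmvt := (convex_closedBall (0 : E) ‖v‖).norm_image_sub_le_of_norm_hasFDerivWithin_le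
    (fun w _ => (hf w).hasFDerivWithinAt) hbound
    (Metric.mem_closedBall_self (norm_nonneg v)) (mem_closedBall_zero_iff.2 le_rfl)
  rw [h0, sub_zero, sub_zero] at hmvt
  rw [norm_pow, norm_norm, pow_succ, ← mul_assoc]
  exact hmvt

section Taylor

variable {E : Type*} [NormedAddCommGroup E] [NormedSpace ℝ E] {G : E → ℝ}

theorem isBigO_fderiv_sub_linear_approx (hG : ContDiff ℝ 3 G) :
    (fun v => fderiv ℝ G v - fderiv ℝ G 0 - fderiv ℝ (fderiv ℝ G) 0 v) =O[nhds 0]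
      fun v => ‖v‖ ^ 2 := by
  have h1 : ContDiff ℝ 2 (fderiv ℝ G) := hG.fderiv_right (by norm_num)
  have h2 : ContDiff ℝ 1 (fderiv ℝ (fderiv ℝ G)) := h1.fderiv_right (by norm_num)
  refine isBigO_norm_pow_succ_of_hasFDerivAt
    (f' := fun v => fderiv ℝ (fderiv ℝ G) v - fderiv ℝ (fderiv ℝ G) 0) (n := 1)
    (fun v => ?_) (by simp) ?_
  · exact (((h1.differentiable (by norm_num)) v).hasFDerivAt.sub_const _).sub
      (fderiv ℝ (fderiv ℝ G) 0).hasFDerivAt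
  · have h3 := ((h2.differentiable (by norm_num)) 0).isBigO_sub
    simpa using h3.norm_right

theorem isBigO_sub_quadratic_approx (hG : ContDiff ℝ 3 G) :
    (fun v => G v - (G 0 + fderiv ℝ G 0 v + fderiv ℝ (fderiv ℝ G) 0 v v / 2)) =O[nhds 0]
      fun v => ‖v‖ ^ 3 := by
  refine isBigO_norm_pow_succ_of_hasFDerivAt (n := 2) (fun v => ?_) (by simp)
    (isBigO_fderiv_sub_linear_approx hG)
  have hB := (fderiv ℝ (fderiv ℝ G) 0).hasFDerivAt (x := v)
  have hBB := (hB.clm_apply (hasFDerivAt_id v)).mul_const (1 / 2 : ℝ)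
  have hd := ((hG.differentiable (by norm_num)) v).hasFDerivAt.sub
    (((fderiv ℝ G 0).hasFDerivAt (x := v)).const_add (G 0) |>.add hBB)
  refine (hd.congr_fderiv ?_).congr_of_eventuallyEq (Filter.Eventually.of_forall fun w => ?_)
  · ext w
    have hs : fderiv ℝ (fderiv ℝ G) 0 w v = fderiv ℝ (fderiv ℝ G) 0 v w :=
      (hG.contDiffAt.isSymmSndFDerivAt (by
        rw [minSmoothness_of_isRCLikeNormedField]
        norm_num)) w v
    simp [hs]
    ring
  · simp
    ring

end Taylor

theorem integral_quartic (a b c d e t : ℝ) :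
    ∫ s in (0 : ℝ)..t, (a + b * s + c * s ^ 2 + d * s ^ 3 + e * s ^ 4) =
      a * t + b * t ^ 2 / 2 + c * t ^ 3 / 3 + d * t ^ 4 / 4 + e * t ^ 5 / 5 := by
  have hd : ∀ s ∈ Set.uIcc 0 t, HasDerivAt (fun s : ℝ => a * s + b * s ^ 2 / 2 + c * s ^ 3 / 3 +
      d * s ^ 4 / 4 + e * s ^ 5 / 5) (a + b * s + c * s ^ 2 + d * s ^ 3 + e * s ^ 4) s := by
    intro s _
    have h := (((((hasDerivAt_id s).const_mul a).add
      (((hasDerivAt_pow 2 s).const_mul b).div_const 2)).add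
      (((hasDerivAt_pow 3 s).const_mul c).div_const 3)).add
      (((hasDerivAt_pow 4 s).const_mul d).div_const 4)).add
      (((hasDerivAt_pow 5 s).const_mul e).div_const 5)
    refine h.congr_deriv ?_
    push_cast
    ring
  rw [intervalIntegral.integral_eq_sub_of_hasDerivAt hd
    (Continuous.intervalIntegrable (by fun_prop) _ _)]
  ring

/-- The quadratic polynomial in three variables with the given coefficients. -/
noncomputable def quadPoly (k l₁ l₂ l₃ b₁₁ b₂₂ b₃₃ b₁₂ b₁₃ b₂₃ x y z : ℝ) : ℝ :=
  k + l₁ * x + l₂ * y + l₃ * z + b₁₁ * x ^ 2 / 2 + b₂₂ * y ^ 2 / 2 + b₃₃ * z ^ 2 / 2 +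
    b₁₂ * x * y + b₁₃ * x * z + b₂₃ * y * z

theorem integral_simplex_quadPoly (k l₁ l₂ l₃ b₁₁ b₂₂ b₃₃ b₁₂ b₁₃ b₂₃ h : ℝ) :
    ∫ x in (0 : ℝ)..h, ∫ y in (0 : ℝ)..x, ∫ z in (0 : ℝ)..y,
      quadPoly k l₁ l₂ l₃ b₁₁ b₂₂ b₃₃ b₁₂ b₁₃ b₂₃ x y z =
    k * h ^ 3 / 6 + (3 * l₁ + 2 * l₂ + l₃) * h ^ 4 / 24 +
      (6 * b₁₁ + 3 * b₂₂ + b₃₃) * h ^ 5 / 60 / 2 +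
      (8 * b₁₂ + 4 * b₁₃ + 3 * b₂₃) * h ^ 5 / 120 := by
  have h₁ : ∀ x y : ℝ, ∫ z in (0 : ℝ)..y, quadPoly k l₁ l₂ l₃ b₁₁ b₂₂ b₃₃ b₁₂ b₁₃ b₂₃ x y z =
      0 + (k + l₁ * x + b₁₁ * x ^ 2 / 2) * y + (l₂ + b₁₂ * x + l₃ / 2 + b₁₃ * x / 2) * y ^ 2 +
        (b₂₂ / 2 + b₃₃ / 6 + b₂₃ / 2) * y ^ 3 + 0 * y ^ 4 := by
    intro x y
    have := integral_quartic (k + l₁ * x + l₂ * y + b₁₁ * x ^ 2 / 2 + b₂₂ * y ^ 2 / 2 +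
      b₁₂ * x * y) (l₃ + b₁₃ * x + b₂₃ * y) (b₃₃ / 2) 0 0 y
    convert this using 1
    · congr 1
      ext z
      rw [quadPoly]
      ring
    · ring
  have h₂ : ∀ x : ℝ, ∫ y in (0 : ℝ)..x, ∫ z in (0 : ℝ)..y,
      quadPoly k l₁ l₂ l₃ b₁₁ b₂₂ b₃₃ b₁₂ b₁₃ b₂₃ x y z =
      0 + 0 * x + k / 2 * x ^ 2 + (l₁ / 2 + l₂ / 3 + l₃ / 6) * x ^ 3 +
        (b₁₁ / 4 + b₁₂ / 3 + b₁₃ / 6 + (b₂₂ / 2 + b₃₃ / 6 + b₂₃ / 2) / 4) * x ^ 4 := by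
    intro x
    simp only [h₁]
    rw [integral_quartic]
    ring
  simp only [h₂]
  rw [integral_quartic]
  ring

theorem integral_simplex_sub {f g : ℝ → ℝ → ℝ → ℝ}
    (hf : Continuous fun v : ℝ × ℝ × ℝ => f v.1 v.2.1 v.2.2)
    (hg : Continuous fun v : ℝ × ℝ × ℝ => g v.1 v.2.1 v.2.2) (h : ℝ) :
    ∫ x in (0 : ℝ)..h, ∫ y in (0 : ℝ)..x, ∫ z in (0 : ℝ)..y, (f x y z - g x y z) =
      (∫ x in (0 : ℝ)..h, ∫ y in (0 : ℝ)..x, ∫ z in (0 : ℝ)..y, f x y z) -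
        ∫ x in (0 : ℝ)..h, ∫ y in (0 : ℝ)..x, ∫ z in (0 : ℝ)..y, g x y z := by
  have c₁ : ∀ {f : ℝ → ℝ → ℝ → ℝ}, Continuous (fun v : ℝ × ℝ × ℝ => f v.1 v.2.1 v.2.2) →
      ∀ x y, Continuous fun z => f x y z := fun hf x y =>
    hf.comp (by fun_prop : Continuous fun z : ℝ => (x, y, z))
  have c₂ : ∀ {f : ℝ → ℝ → ℝ → ℝ}, Continuous (fun v : ℝ × ℝ × ℝ => f v.1 v.2.1 v.2.2) →
      Continuous fun v : ℝ × ℝ => ∫ z in (0 : ℝ)..v.2, f v.1 v.2 z := fun {f} hf =>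
    intervalIntegral.continuous_parametric_intervalIntegral_of_continuous
      (f := fun (v : ℝ × ℝ) z => f v.1 v.2 z) (s := fun v => v.2)
      (hf.comp (by fun_prop : Continuous fun w : (ℝ × ℝ) × ℝ => (w.1.1, w.1.2, w.2)))
      continuous_snd
  have c₃ : ∀ {f : ℝ → ℝ → ℝ → ℝ}, Continuous (fun v : ℝ × ℝ × ℝ => f v.1 v.2.1 v.2.2) →
      Continuous fun x : ℝ => ∫ y in (0 : ℝ)..x, ∫ z in (0 : ℝ)..y, f x y z := fun {f} hf =>
    intervalIntegral.continuous_parametric_intervalIntegral_of_continuous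
      (f := fun x y => ∫ z in (0 : ℝ)..y, f x y z) (s := fun x => x) (c₂ hf) continuous_id
  rw [← intervalIntegral.integral_sub ((c₃ hf).intervalIntegrable _ _)
    ((c₃ hg).intervalIntegrable _ _)]
  congr 1
  ext x
  refine Eq.trans ?_ (intervalIntegral.integral_sub
    (((c₂ hf).comp (by fun_prop : Continuous fun y : ℝ => (x, y))).intervalIntegrable _ _)
    (((c₂ hg).comp (by fun_prop : Continuous fun y : ℝ => (x, y))).intervalIntegrable _ _))
  congr 1
  ext y
  exact intervalIntegral.integral_sub ((c₁ hf x y).intervalIntegrable _ _)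
    ((c₁ hg x y).intervalIntegrable _ _)

theorem abs_integral_simplex_le {f : ℝ → ℝ → ℝ → ℝ} {h C : ℝ} (hh : 0 ≤ h) (hC : 0 ≤ C)
    (hf : ∀ x ∈ Set.Icc 0 h, ∀ y ∈ Set.Icc 0 h, ∀ z ∈ Set.Icc 0 h, |f x y z| ≤ C) :
    |∫ x in (0 : ℝ)..h, ∫ y in (0 : ℝ)..x, ∫ z in (0 : ℝ)..y, f x y z| ≤ C * h ^ 3 := by
  have step : ∀ {u : ℝ → ℝ} {K t : ℝ}, 0 ≤ K → t ∈ Set.Icc 0 h →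
      (∀ s ∈ Set.Icc 0 h, |u s| ≤ K) → |∫ s in (0 : ℝ)..t, u s| ≤ K * h := by
    intro u K t hK ht hu
    have := intervalIntegral.norm_integral_le_of_norm_le_const (a := 0) (b := t) (f := u) (C := K)
      (fun s hs => by
        rw [Set.uIoc_of_le ht.1] at hs
        exact hu s ⟨hs.1.le, hs.2.trans ht.2⟩)
    rw [sub_zero, abs_of_nonneg ht.1] at this
    exact this.trans (by gcongr; exact ht.2)
  have := step (by positivity : 0 ≤ C * h * h) ⟨hh, le_rfl⟩ fun x hx =>
    step (by positivity : 0 ≤ C * h) hx fun y hy => step hC hy (hf x hx y hy)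
  calc _ ≤ _ := this
    _ = _ := by ring

theorem isBigO_integral_simplex {f : ℝ → ℝ → ℝ → ℝ}
    (hf : (fun v : ℝ × ℝ × ℝ => f v.1 v.2.1 v.2.2) =O[nhds 0] fun v => ‖v‖ ^ 3) :
    (fun h : ℝ => ∫ x in (0 : ℝ)..h, ∫ y in (0 : ℝ)..x, ∫ z in (0 : ℝ)..y, f x y z)
      =O[nhdsWithin 0 (Set.Ioi 0)] fun h : ℝ => h ^ 6 := by
  obtain ⟨c, hc, hb⟩ := hf.exists_nonneg
  obtain ⟨δ, hδ, hball⟩ := Metric.eventually_nhds_iff_ball.1 hb.bound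
  refine IsBigO.of_bound c ?_
  filter_upwards [Ioo_mem_nhdsGT hδ] with h hh
  have h0 : 0 ≤ h := hh.1.le
  have key := abs_integral_simplex_le (f := f) h0 (by positivity : 0 ≤ c * h ^ 3)
    fun x hx y hy z hz => by
      have hn : ‖(x, y, z)‖ ≤ h := by
        simp only [Prod.norm_mk, Real.norm_eq_abs, sup_le_iff, abs_le]
        refine ⟨⟨?_, hx.2⟩, ⟨?_, hy.2⟩, ⟨?_, hz.2⟩⟩
        · linarith [hx.1]
        · linarith [hy.1]
        · linarith [hz.1]
      have := hball (x, y, z) (mem_ball_zero_iff.2 (hn.trans_lt hh.2))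
      rw [norm_pow, norm_norm] at this
      exact this.trans (by gcongr)
  rw [Real.norm_eq_abs, norm_pow, Real.norm_eq_abs, abs_of_nonneg h0]
  calc _ ≤ _ := key
    _ = _ := by ring

theorem isBigO_comp_ray {n : ℕ} {f : ℝ × ℝ × ℝ → ℝ} (hf : f =O[nhds 0] fun v => ‖v‖ ^ n)
    (w : ℝ × ℝ × ℝ) :
    (fun h : ℝ => f (h • w)) =O[nhdsWithin 0 (Set.Ioi 0)] fun h : ℝ => h ^ n := by
  have ht : Filter.Tendsto (fun h : ℝ => h • w) (nhdsWithin 0 (Set.Ioi 0)) (nhds 0) := by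
    have : Filter.Tendsto (fun h : ℝ => h • w) (nhds 0) (nhds ((0 : ℝ) • w)) :=
      (by fun_prop : Continuous fun h : ℝ => h • w).tendsto 0
    rw [zero_smul] at this
    exact this.mono_left nhdsWithin_le_nhds
  refine (hf.comp_tendsto ht).trans (IsBigO.of_bound (‖w‖ ^ n) (Filter.Eventually.of_forall ?_))
  intro h
  simp only [Function.comp, norm_smul, norm_pow, norm_mul, norm_norm]
  rw [mul_pow, mul_comm]

section Partial

variable {g : ℝ → ℝ → ℝ → ℝ}

theorem pd1_eq_fderiv (hg : Differentiable ℝ fun v : ℝ × ℝ × ℝ => g v.1 v.2.1 v.2.2) (x y z : ℝ) :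
    pd1 g x y z = fderiv ℝ (fun v : ℝ × ℝ × ℝ => g v.1 v.2.1 v.2.2) (x, y, z) (1, 0, 0) := by
  have hl : HasDerivAt (fun s : ℝ => (s, y, z)) (1, 0, 0) x :=
    (hasDerivAt_id x).prodMk ((hasDerivAt_const x y).prodMk (hasDerivAt_const x z))
  exact ((hg (x, y, z)).hasFDerivAt.comp_hasDerivAt x hl).deriv

theorem pd2_eq_fderiv (hg : Differentiable ℝ fun v : ℝ × ℝ × ℝ => g v.1 v.2.1 v.2.2) (x y z : ℝ) :
    pd2 g x y z = fderiv ℝ (fun v : ℝ × ℝ × ℝ => g v.1 v.2.1 v.2.2) (x, y, z) (0, 1, 0) := by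
  have hl : HasDerivAt (fun s : ℝ => (x, s, z)) (0, 1, 0) y :=
    (hasDerivAt_const y x).prodMk ((hasDerivAt_id y).prodMk (hasDerivAt_const y z))
  exact ((hg (x, y, z)).hasFDerivAt.comp_hasDerivAt y hl).deriv

theorem pd3_eq_fderiv (hg : Differentiable ℝ fun v : ℝ × ℝ × ℝ => g v.1 v.2.1 v.2.2) (x y z : ℝ) :
    pd3 g x y z = fderiv ℝ (fun v : ℝ × ℝ × ℝ => g v.1 v.2.1 v.2.2) (x, y, z) (0, 0, 1) := by
  have hl : HasDerivAt (fun s : ℝ => (x, y, s)) (0, 0, 1) z :=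
    (hasDerivAt_const z x).prodMk ((hasDerivAt_const z y).prodMk (hasDerivAt_id z))
  exact ((hg (x, y, z)).hasFDerivAt.comp_hasDerivAt z hl).deriv

end Partial

set_option maxRecDepth 10000 in
theorem quadrature_quadPoly_eq {τ p q r : ℝ} (hτ : 1 - 2 * τ ≠ 0)
    (hp : p = 1 / (6 * (1 - 2 * τ) ^ 2)) (hq : q = 1 - 2 * p)
    (hr : r = (1 / 12) * (1 - 1 / (1 - 2 * τ) + 1 / (6 * (1 - 2 * τ) ^ 3)))
    (k l₁ l₂ l₃ b₁₁ b₂₂ b₃₃ b₁₂ b₁₃ b₂₃ h : ℝ) {P : ℝ → ℝ → ℝ → ℝ}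
    (hP : P = quadPoly k l₁ l₂ l₃ b₁₁ b₂₂ b₃₃ b₁₂ b₁₃ b₂₃) {a m c : ℝ}
    (ha : a = τ * h) (hm : m = h / 2) (hc : c = (1 - τ) * h) :
    (k * h ^ 3 / 6 + (3 * l₁ + 2 * l₂ + l₃) * h ^ 4 / 24 +
      (6 * b₁₁ + 3 * b₂₂ + b₃₃) * h ^ 5 / 60 / 2 +
      (8 * b₁₂ + 4 * b₁₃ + 3 * b₂₃) * h ^ 5 / 120) -
    (h^3 * (p^3/6   * P c c c
          + p^2*q/2 * P c c m
          + p^3/2   * P c c a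
          + p*q^2/2 * P c m m
          + p^2*q   * P c m a
          + p^3/2   * P c a a
          + q^3/6   * P m m m
          + p*q^2/2 * P m m a
          + p^2*q/2 * P m a a
          + p^3/6   * P a a a)
     + h^4 * p * r * ((l₂ + b₁₂ * c + b₂₂ * m + b₂₃ * m) - (l₃ + b₁₃ * c + b₂₃ * m + b₃₃ * m))
     + h^4 * (q * r / 2) *
        ((l₁ + b₁₁ * m + b₁₂ * m + b₁₃ * m) - (l₃ + b₁₃ * m + b₂₃ * m + b₃₃ * m))
     + h^4 * p * r * ((l₁ + b₁₁ * m + b₁₂ * m + b₁₃ * a) - (l₂ + b₁₂ * m + b₂₂ * m + b₂₃ * a)))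
      + h^5 * (432*τ^4 - 864*τ^3 + 558*τ^2 - 126*τ + 7) / (12960 * (1 - 2*τ)^4) *
          (b₁₁ - 2 * b₂₂ + b₃₃)
      - h^5 * (216*τ^4 - 252*τ^3 + 99*τ^2 - 18*τ + 1) / (3240 * (1 - 2*τ)^4) *
          (b₁₂ - 2 * b₁₃ + b₂₃) = 0 := by
  obtain ⟨u, hu⟩ : ∃ u, u = 1 - 2 * τ := ⟨_, rfl⟩
  have hτu : τ = (1 - u) / 2 := by linarith
  rw [← hu] at hτ hp hr ⊢
  subst hP hr hq hp ha hm hc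
  simp only [quadPoly]
  rw [hτu]
  field_simp
  ring

theorem fderiv_fderiv_apply {E : Type*} [NormedAddCommGroup E] [NormedSpace ℝ E] {G : E → ℝ}
    (hG : ContDiff ℝ 3 G) (x v w : E) :
    fderiv ℝ (fun y => fderiv ℝ G y w) x v = fderiv ℝ (fderiv ℝ G) x v w := by
  have h1 : ContDiff ℝ 2 (fderiv ℝ G) := hG.fderiv_right (by norm_num)
  have h2 := (((h1.differentiable (by norm_num)) x).hasFDerivAt.clm_apply
    (hasFDerivAt_const w x)).fderiv
  rw [h2]
  simp

theorem differentiable_fderiv_apply {E : Type*} [NormedAddCommGroup E] [NormedSpace ℝ E]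
    {G : E → ℝ} (hG : ContDiff ℝ 3 G) (w : E) : Differentiable ℝ fun y => fderiv ℝ G y w := by
  have h1 : ContDiff ℝ 2 (fderiv ℝ G) := hG.fderiv_right (by norm_num)
  exact (h1.differentiable (by norm_num)).clm_apply (differentiable_const w)

theorem triple_eq_smul_add (v : ℝ × ℝ × ℝ) :
    v = v.1 • ((1, 0, 0) : ℝ × ℝ × ℝ) + v.2.1 • ((0, 1, 0) : ℝ × ℝ × ℝ) +
      v.2.2 • ((0, 0, 1) : ℝ × ℝ × ℝ) := by
  ext <;> simp

theorem isBigO_sub_quadPoly_pd {g : ℝ → ℝ → ℝ → ℝ}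
    (hg : ContDiff ℝ 3 (fun v : ℝ × ℝ × ℝ => g v.1 v.2.1 v.2.2)) :
    (fun v : ℝ × ℝ × ℝ => g v.1 v.2.1 v.2.2 - quadPoly (g 0 0 0) (pd1 g 0 0 0) (pd2 g 0 0 0)
        (pd3 g 0 0 0) (pd1 (pd1 g) 0 0 0) (pd2 (pd2 g) 0 0 0) (pd3 (pd3 g) 0 0 0)
        (pd1 (pd2 g) 0 0 0) (pd1 (pd3 g) 0 0 0) (pd2 (pd3 g) 0 0 0) v.1 v.2.1 v.2.2)
        =O[nhds 0] (fun v => ‖v‖ ^ 3) ∧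
    (fun v : ℝ × ℝ × ℝ => pd1 g v.1 v.2.1 v.2.2 - (pd1 g 0 0 0 + pd1 (pd1 g) 0 0 0 * v.1 +
        pd1 (pd2 g) 0 0 0 * v.2.1 + pd1 (pd3 g) 0 0 0 * v.2.2))
        =O[nhds 0] (fun v => ‖v‖ ^ 2) ∧
    (fun v : ℝ × ℝ × ℝ => pd2 g v.1 v.2.1 v.2.2 - (pd2 g 0 0 0 + pd1 (pd2 g) 0 0 0 * v.1 +
        pd2 (pd2 g) 0 0 0 * v.2.1 + pd2 (pd3 g) 0 0 0 * v.2.2))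
        =O[nhds 0] (fun v => ‖v‖ ^ 2) ∧
    (fun v : ℝ × ℝ × ℝ => pd3 g v.1 v.2.1 v.2.2 - (pd3 g 0 0 0 + pd1 (pd3 g) 0 0 0 * v.1 +
        pd2 (pd3 g) 0 0 0 * v.2.1 + pd3 (pd3 g) 0 0 0 * v.2.2))
        =O[nhds 0] (fun v => ‖v‖ ^ 2) := by
  obtain ⟨G, hG⟩ : ∃ G : ℝ × ℝ × ℝ → ℝ, G = fun v => g v.1 v.2.1 v.2.2 := ⟨_, rfl⟩
  have hgv : ∀ x y z, g x y z = G (x, y, z) := fun x y z => by rw [hG]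
  have hgd := hg.differentiable (by norm_num)
  have e₁ : pd1 g = fun x y z => fderiv ℝ G (x, y, z) (1, 0, 0) := by
    ext x y z
    rw [hG, pd1_eq_fderiv hgd]
  have e₂ : pd2 g = fun x y z => fderiv ℝ G (x, y, z) (0, 1, 0) := by
    ext x y z
    rw [hG, pd2_eq_fderiv hgd]
  have e₃ : pd3 g = fun x y z => fderiv ℝ G (x, y, z) (0, 0, 1) := by
    ext x y z
    rw [hG, pd3_eq_fderiv hgd]
  rw [← hG] at hg
  obtain ⟨B, hB⟩ : ∃ B, B = fderiv ℝ (fderiv ℝ G) 0 := ⟨_, rfl⟩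
  have d₁ : ∀ w, pd1 (fun x y z => fderiv ℝ G (x, y, z) w) 0 0 0 = B (1, 0, 0) w := fun w => by
    rw [pd1_eq_fderiv (differentiable_fderiv_apply hg w), hB]
    exact fderiv_fderiv_apply hg _ _ _
  have d₂ : ∀ w, pd2 (fun x y z => fderiv ℝ G (x, y, z) w) 0 0 0 = B (0, 1, 0) w := fun w => by
    rw [pd2_eq_fderiv (differentiable_fderiv_apply hg w), hB]
    exact fderiv_fderiv_apply hg _ _ _
  have d₃ : ∀ w, pd3 (fun x y z => fderiv ℝ G (x, y, z) w) 0 0 0 = B (0, 0, 1) w := fun w => by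
    rw [pd3_eq_fderiv (differentiable_fderiv_apply hg w), hB]
    exact fderiv_fderiv_apply hg _ _ _
  have hs : ∀ v w, B v w = B w v := fun v w => by
    rw [hB]
    exact (hg.contDiffAt.isSymmSndFDerivAt (by
      rw [minSmoothness_of_isRCLikeNormedField]
      norm_num)) v w
  have hBv : ∀ v w : ℝ × ℝ × ℝ, B v w =
      v.1 * B (1, 0, 0) w + v.2.1 * B (0, 1, 0) w + v.2.2 * B (0, 0, 1) w := fun v w => by
    conv_lhs => rw [triple_eq_smul_add v]
    simp only [map_add, map_smul, add_apply, smul_apply,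
      smul_eq_mul]
  have hLv : ∀ v : ℝ × ℝ × ℝ, fderiv ℝ G 0 v = v.1 * fderiv ℝ G 0 (1, 0, 0) +
      v.2.1 * fderiv ℝ G 0 (0, 1, 0) + v.2.2 * fderiv ℝ G 0 (0, 0, 1) := fun v => by
    conv_lhs => rw [triple_eq_smul_add v]
    simp only [map_add, map_smul, smul_eq_mul]
  have hz : ((0, 0, 0) : ℝ × ℝ × ℝ) = 0 := rfl
  have hD : ∀ w : ℝ × ℝ × ℝ, (fun v => fderiv ℝ G v w - (fderiv ℝ G 0 w + B v w)) =O[nhds 0]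
      fun v => ‖v‖ ^ 2 := fun w => by
    have h1 := (ContinuousLinearMap.apply ℝ ℝ w).isBigO_comp
      (fun v => fderiv ℝ G v - fderiv ℝ G 0 - fderiv ℝ (fderiv ℝ G) 0 v) (nhds 0)
    refine (h1.trans (isBigO_fderiv_sub_linear_approx hg)).congr_left fun v => ?_
    simp only [ContinuousLinearMap.apply_apply, sub_apply, hB]
    ring
  simp only [e₁, e₂, e₃, d₁, d₂, d₃, hgv, hz, Prod.mk.eta]
  refine ⟨(isBigO_sub_quadratic_approx hg).congr_left fun v => ?_,
    (hD (1, 0, 0)).congr_left fun v => ?_, (hD (0, 1, 0)).congr_left fun v => ?_,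
    (hD (0, 0, 1)).congr_left fun v => ?_⟩
  · rw [← hB, hLv v, hBv v v, hs _ v, hs (0, 1, 0) v, hs (0, 0, 1) v, hBv v, hBv v (0, 1, 0),
      hBv v (0, 0, 1), hs (0, 1, 0) (1, 0, 0), hs (0, 0, 1) (1, 0, 0), hs (0, 0, 1) (0, 1, 0),
      quadPoly]
    ring
  · rw [hBv v, hs (0, 1, 0) (1, 0, 0), hs (0, 0, 1) (1, 0, 0)]
    ring
  · rw [hBv v, hs (0, 0, 1) (0, 1, 0)]
    ring
  · rw [hBv v]
    ring

theorem R3_dominant_term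
    (τ : ℝ) (hτ : τ ∈ Set.Ico (0:ℝ) (1/2))
    (g : ℝ → ℝ → ℝ → ℝ)
    (hg : ContDiff ℝ 3 (fun v : ℝ × ℝ × ℝ => g v.1 v.2.1 v.2.2)) :
    (fun h : ℝ =>
      R₃ τ g h
      + h^5 * (432*τ^4 - 864*τ^3 + 558*τ^2 - 126*τ + 7) / (12960 * (1 - 2*τ)^4) *
          (pd1 (pd1 g) 0 0 0 - 2 * pd2 (pd2 g) 0 0 0 + pd3 (pd3 g) 0 0 0)
      - h^5 * (216*τ^4 - 252*τ^3 + 99*τ^2 - 18*τ + 1) / (3240 * (1 - 2*τ)^4) *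
          (pd1 (pd2 g) 0 0 0 - 2 * pd1 (pd3 g) 0 0 0 + pd2 (pd3 g) 0 0 0))
      =O[nhdsWithin 0 (Set.Ioi 0)] fun h : ℝ => h^6 := by
  obtain ⟨hE, hD₁, hD₂, hD₃⟩ := isBigO_sub_quadPoly_pd hg
  have hτ' : 1 - 2 * τ ≠ 0 := by linarith [hτ.2]
  obtain ⟨p, hp⟩ : ∃ p, p = 1 / (6 * (1 - 2 * τ) ^ 2) := ⟨_, rfl⟩
  obtain ⟨q, hq⟩ : ∃ q, q = 1 - 2 * p := ⟨_, rfl⟩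
  obtain ⟨r, hr⟩ : ∃ r, r = (1 / 12) * (1 - 1 / (1 - 2 * τ) + 1 / (6 * (1 - 2 * τ) ^ 3)) :=
    ⟨_, rfl⟩
  obtain ⟨P, hP⟩ : ∃ P, P = quadPoly (g 0 0 0) (pd1 g 0 0 0) (pd2 g 0 0 0)
    (pd3 g 0 0 0) (pd1 (pd1 g) 0 0 0) (pd2 (pd2 g) 0 0 0) (pd3 (pd3 g) 0 0 0)
    (pd1 (pd2 g) 0 0 0) (pd1 (pd3 g) 0 0 0) (pd2 (pd3 g) 0 0 0) := ⟨_, rfl⟩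
  have hPc : Continuous fun v : ℝ × ℝ × ℝ => P v.1 v.2.1 v.2.2 := by
    rw [hP]
    unfold quadPoly
    fun_prop
  rw [← hP] at hE
  have hint := integral_simplex_quadPoly (g 0 0 0) (pd1 g 0 0 0) (pd2 g 0 0 0)
    (pd3 g 0 0 0) (pd1 (pd1 g) 0 0 0) (pd2 (pd2 g) 0 0 0) (pd3 (pd3 g) 0 0 0)
    (pd1 (pd2 g) 0 0 0) (pd1 (pd3 g) 0 0 0) (pd2 (pd3 g) 0 0 0)
  rw [← hP] at hint
  have hI := isBigO_integral_simplex (f := fun x y z => g x y z - P x y z) hE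
  simp only [integral_simplex_sub hg.continuous hPc, hint] at hI
  have hval : ∀ w α β γ : ℝ, (fun h : ℝ => w * h ^ 3 *
      (g (α * h) (β * h) (γ * h) - P (α * h) (β * h) (γ * h)))
      =O[nhdsWithin 0 (Set.Ioi 0)] fun h : ℝ => h ^ 6 := fun w α β γ => by
    have h1 := ((isBigO_refl (fun h : ℝ => h ^ 3) (nhdsWithin 0 (Set.Ioi 0))).const_mul_left w).mul
      (isBigO_comp_ray hE (α, β, γ))
    refine (h1.congr_left fun h => ?_).congr_right fun h => ?_
    · simp only [Prod.smul_mk, smul_eq_mul, mul_comm h]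
    · ring
  have hder : ∀ {f : ℝ × ℝ × ℝ → ℝ}, f =O[nhds 0] (fun v => ‖v‖ ^ 2) → ∀ w α β γ : ℝ,
      (fun h : ℝ => w * h ^ 4 * f (α * h, β * h, γ * h))
      =O[nhdsWithin 0 (Set.Ioi 0)] fun h : ℝ => h ^ 6 := fun {f} hf w α β γ => by
    have h1 := ((isBigO_refl (fun h : ℝ => h ^ 4) (nhdsWithin 0 (Set.Ioi 0))).const_mul_left w).mul
      (isBigO_comp_ray hf (α, β, γ))
    refine (h1.congr_left fun h => ?_).congr_right fun h => ?_
    · simp only [Prod.smul_mk, smul_eq_mul, mul_comm h]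
    · ring
  have hsum := (((((((((((((((hval (p^3/6) (1 - τ) (1 - τ) (1 - τ)).add
    (hval (p^2*q/2) (1 - τ) (1 - τ) (1 / 2))).add
    (hval (p^3/2) (1 - τ) (1 - τ) τ)).add
    (hval (p*q^2/2) (1 - τ) (1 / 2) (1 / 2))).add
    (hval (p^2*q) (1 - τ) (1 / 2) τ)).add
    (hval (p^3/2) (1 - τ) τ τ)).add
    (hval (q^3/6) (1 / 2) (1 / 2) (1 / 2))).add
    (hval (p*q^2/2) (1 / 2) (1 / 2) τ)).add
    (hval (p^2*q/2) (1 / 2) τ τ)).add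
    (hval (p^3/6) τ τ τ)).add
    (hder hD₂ (p * r) (1 - τ) (1 / 2) (1 / 2))).add
    (hder hD₃ (-(p * r)) (1 - τ) (1 / 2) (1 / 2))).add
    (hder hD₁ (q * r / 2) (1 / 2) (1 / 2) (1 / 2))).add
    (hder hD₃ (-(q * r / 2)) (1 / 2) (1 / 2) (1 / 2))).add
    (hder hD₁ (p * r) (1 / 2) (1 / 2) τ)).add
    (hder hD₂ (-(p * r)) (1 / 2) (1 / 2) τ)
  refine (hI.sub hsum).congr_left fun h => ?_
  have key := quadrature_quadPoly_eq hτ' hp hq hr _ _ _ _ _ _ _ _ _ _ h hP rfl rfl rfl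
  have hm : h / 2 = 1 / 2 * h := by ring
  simp only [R₃, ← hp, ← hq, ← hr]
  rw [hm] at key ⊢
  linear_combination -key
end
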